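/- Let φ be a Boolean formula over variables x_1,…,x_n, let G_φ be the one-player cycle arena constructed from φ with single player p, and let α=(O_p) with O_p=Muller(φ). Then φ is unsatisfiable if and only if every profile t∈T_{G_φ,α,Pos} satisfies out(t)∈Muller(¬φ). -/

import Mathlib

open scoped Classical

namespace EpistemicRV

/-- Boolean formulas over variables of type `α`. -/
inductive BForm (α : Type) : Type where
  | tru : BForm α
  | fls : BForm α
  | var : α → BForm α
  | not : BForm α → BForm α
  | and : BForm α → BForm α → BForm α
  | or : BForm α → BForm α → BForm α

/-- Evaluation of a Boolean formula under a truth assignment. -/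
def BForm.eval {α : Type} (θ : α → Prop) : BForm α → Prop
  | .tru => True
  | .fls => False
  | .var a => θ a
  | .not f => ¬ (f.eval θ)
  | .and f g => f.eval θ ∧ g.eval θ
  | .or f g => f.eval θ ∨ g.eval θ

/-- Renaming of variables of a Boolean formula. -/
def BForm.map {α β : Type} (h : α → β) : BForm α → BForm β
  | .tru => .tru
  | .fls => .fls
  | .var a => .var (h a)
  | .not f => .not (f.map h)
  | .and f g => .and (f.map h) (g.map h)
  | .or f g => .or (f.map h) (g.map h)

/-- A game arena: each vertex has an owner, there is an initial vertex and an
edge relation.  (Totality of the edge relation is stated as a separate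
hypothesis where needed.) -/
structure Arena (P V : Type) : Type where
  owner : V → P
  v0 : V
  edge : V → V → Prop

/-- A strategy: given the (reversed) past history and the current vertex,
it yields the next vertex.  A history `h v` (ending in the current vertex `v`)
is represented by the pair of the reversed list `h` and `v`. -/
abbrev Strat (V : Type) : Type := List V → V → V

/-- A strategy profile assigns a strategy to every player. -/
abbrev Profile (P V : Type) : Type := P → Strat V

variable {P V : Type}

/-- A strategy respecting the edge relation. -/
def ValidStrat (A : Arena P V) (s : Strat V) : Prop := ∀ h v, A.edge v (s h v)

/-- A positional strategy only depends on the current vertex. -/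
def PositionalStrat (s : Strat V) : Prop := ∀ h h' v, s h v = s h' v

/-- The class Σ of all strategies. -/
def allClass (A : Arena P V) : Set (Strat V) := {s | ValidStrat A s}

/-- The class Pos of positional strategies. -/
def posClass (A : Arena P V) : Set (Strat V) := {s | ValidStrat A s ∧ PositionalStrat s}

/-- Strategy profiles ranging over the class `C` of strategies. -/
def profiles (A : Arena P V) (C : Set (Strat V)) : Set (Profile P V) :=
  {s | ∀ p, s p ∈ C}

/-- `upd s p t` is the profile `s[p ↦ t]`. -/
noncomputable def upd (s : Profile P V) (p : P) (t : Strat V) : Profile P V :=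
  fun q => if q = p then t else s q

/-- The reversed history of length `n+1` generated by the profile `s`. -/
def histOf (A : Arena P V) (s : Profile P V) : ℕ → List V
  | 0 => [A.v0]
  | n + 1 =>
    match histOf A s n with
    | [] => [A.v0]
    | v :: h => s (A.owner v) h v :: v :: h

/-- The outcome play `out(s)` of the profile `s`. -/
def Out (A : Arena P V) (s : Profile P V) : ℕ → V :=
  fun n => (histOf A s n).getD 0 A.v0

/-- The set of plays of an arena. -/
def plays (A : Arena P V) : Set (ℕ → V) :=
  {ρ | ρ 0 = A.v0 ∧ ∀ i, A.edge (ρ i) (ρ (i + 1))}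

/-- `Inf(ρ)`: the set of vertices occurring infinitely often in `ρ`. -/
def InfSet (ρ : ℕ → V) : Set V := {v | ∀ i, ∃ j, i ≤ j ∧ ρ j = v}

/-- The Büchi objective for the set `U` of vertices. -/
def Buchi (U : Set V) : Set (ℕ → V) := {ρ | (InfSet ρ ∩ U).Nonempty}

/-- The Muller objective for a Boolean formula over the vertices. -/
def Muller (φ : BForm V) : Set (ℕ → V) := {ρ | φ.eval (fun v => v ∈ InfSet ρ)}

/-- `s` is a Nash equilibrium for the objective profile `O` and the class `C`. -/
def NashEq (A : Arena P V) (O : P → Set (ℕ → V)) (C : Set (Strat V))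
    (s : Profile P V) : Prop :=
  ∀ p, ∀ t ∈ C, Out A (upd s p t) ∈ O p → Out A s ∈ O p

/-- `t` is a winning strategy of player `p` for objective `Op` over class `C`. -/
def WinningStrat (A : Arena P V) (Op : Set (ℕ → V)) (C : Set (Strat V))
    (p : P) (t : Strat V) : Prop :=
  t ∈ C ∧ ∀ s ∈ profiles A C, Out A (upd s p t) ∈ Op

/-- Knowledge operator of a single accessibility relation. -/
def Kop {W : Type} (R : W → W → Prop) (E : Set W) : Set W :=
  {w | ∀ w', R w w' → w' ∈ E}

/-- Mutual knowledge operator. -/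
def MKop {W : Type} (R : P → W → W → Prop) (E : Set W) : Set W :=
  ⋂ p, Kop (R p) E

/-- Common knowledge operator: `CK(E) = ⋂_{i ≥ 1} MK^i(E)`. -/
def CKop {W : Type} (R : P → W → W → Prop) (E : Set W) : Set W :=
  ⋂ i ∈ Set.Ici (1 : ℕ), (MKop R)^[i] E

/-- Player `p` is rational in world `w` (for arena `A`, objective profile `O`,
class `C`, accessibility relations `R` and strategy assignment `σ`). -/
def RationalIn (A : Arena P V) (O : P → Set (ℕ → V)) (C : Set (Strat V))
    {W : Type} (R : P → W → W → Prop) (σ : W → Profile P V) (p : P) (w : W) : Prop :=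
  ¬ ∃ t ∈ C,
      (∀ w', R p w w' → (Out A (σ w') ∈ O p → Out A (upd (σ w') p t) ∈ O p)) ∧
      (∃ w', R p w w' ∧ Out A (σ w') ∉ O p ∧ Out A (upd (σ w') p t) ∈ O p)

/-- The set of worlds in which every player is rational. -/
def RAT (A : Arena P V) (O : P → Set (ℕ → V)) (C : Set (Strat V))
    {W : Type} (R : P → W → W → Prop) (σ : W → Profile P V) : Set W :=
  {w | ∀ p, RationalIn A O C R σ p w}

/-- An epistemic model for the arena `A` and the class `C` of strategies. -/
structure EModel {P V : Type} (A : Arena P V) (C : Set (Strat V)) : Type 1 where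
  W : Type
  finW : Finite W
  R : P → W → W → Prop
  equivR : ∀ p, Equivalence (R p)
  σ : W → Profile P V
  memC : ∀ w, σ w ∈ profiles A C
  consistent : ∀ p w w', R p w w' → σ w p = σ w' p

/-- The characterization `T_{G,α,S}` of common knowledge of rationality. -/
def Tchar (A : Arena P V) (O : P → Set (ℕ → V)) (C : Set (Strat V)) :
    Set (Profile P V) :=
  {s | ∃ M : EModel A C, ∃ w : M.W,
        w ∈ CKop M.R (RAT A O C M.R M.σ) ∧ M.σ w = s}

end EpistemicRV

namespace EpistemicRV

/-- Vertices of the one-player cycle arena `G_φ`: choice vertices `v i` and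
literal vertices `x i b` (`b = true` is the positive literal). -/
inductive OneV (n : ℕ) : Type where
  | v : Fin n → OneV n
  | x : Fin n → Bool → OneV n

/-- Edges of the one-player cycle arena: `v_i → x_i, x̄_i` and
`x_i, x̄_i → v_{i+1}` (or back to `v_1` when `i = n`). -/
def oneEdge {n : ℕ} : OneV n → OneV n → Prop
  | .v i, .x i' _ => i = i'
  | .x i _, .v i' => (i : ℕ) + 1 = (i' : ℕ) ∨ ((i : ℕ) + 1 = n ∧ (i' : ℕ) = 0)
  | _, _ => False

/-- The one-player cycle arena with single player `() : Unit`. -/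
def oneArena (n : ℕ) (hn : 0 < n) : Arena Unit (OneV n) where
  owner := fun _ => ()
  v0 := .v ⟨0, hn⟩
  edge := oneEdge

/-- The positive literal vertex of a variable. -/
def oneLit {n : ℕ} : Fin n → OneV n := fun i => .x i true

theorem BForm.eval_map {α β : Type} (h : α → β) (θ : β → Prop) (φ : BForm α) :
    (φ.map h).eval θ ↔ φ.eval (fun a => θ (h a)) := by
  induction φ <;> simp_all [BForm.map, BForm.eval]

theorem Out_memoryless {P V : Type} (A : Arena P V) (g : V → V) (m : ℕ) :
    Out A (fun _ _ v => g v) m = g^[m] A.v0 := by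
  have hist : ∃ h, histOf A (fun _ _ v => g v) m = g^[m] A.v0 :: h := by
    induction m with
    | zero => exact ⟨[], rfl⟩
    | succ m ih =>
      obtain ⟨h, hh⟩ := ih
      exact ⟨g^[m] A.v0 :: h, by simp [histOf, hh, Function.iterate_succ_apply']⟩
  obtain ⟨h, hh⟩ := hist
  simp [Out, hh]

theorem CKop_univ {P W : Type} (R : P → W → W → Prop) : CKop R Set.univ = Set.univ := by
  have fixed : MKop R Set.univ = Set.univ := by simp [MKop, Kop]
  simp [CKop, Function.iterate_fixed fixed]

/-- A profile whose outcome meets every player's objective is played under common knowledge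
of rationality. -/
theorem mem_Tchar_of_forall_Out_mem {P V : Type} {A : Arena P V} {O : P → Set (ℕ → V)}
    {C : Set (Strat V)} {s : Profile P V} (hs : s ∈ profiles A C) (hO : ∀ p, Out A s ∈ O p) :
    s ∈ Tchar A O C := by
  let M : EModel A C :=
    { W := Unit
      finW := inferInstance
      R := fun _ _ _ => True
      equivR := fun _ => ⟨fun _ => trivial, fun _ => trivial, fun _ _ => trivial⟩
      σ := fun _ => s
      memC := fun _ => hs
      consistent := fun _ _ _ _ => rfl }
  have rat : RAT A O C M.R M.σ = Set.univ :=
    Set.eq_univ_of_forall fun _ p ⟨_, _, _, _, _, hnot, _⟩ => hnot (hO p)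
  exact ⟨M, (), by rw [rat, CKop_univ]; trivial, rfl⟩

/-- The move of the cycle arena that chooses literals according to the assignment `f`. -/
noncomputable def assignmentMove {n : ℕ} (f : Fin n → Prop) : OneV n → OneV n
  | .v i => .x i (decide (f i))
  | .x i _ => .v ⟨(i + 1) % n, Nat.mod_lt _ i.pos⟩

theorem oneEdge_assignmentMove {n : ℕ} (f : Fin n → Prop) (u : OneV n) :
    oneEdge u (assignmentMove f u) := by
  cases u with
  | v i => rfl
  | x i b =>
    rcases Nat.lt_or_ge (i + 1) n with h | h
    · exact Or.inl (Nat.mod_eq_of_lt h).symm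
    · have h' : (i : ℕ) + 1 = n := by omega
      exact Or.inr ⟨h', by simp [h']⟩

theorem iterate_assignmentMove_two_mul {n : ℕ} (hn : 0 < n) (f : Fin n → Prop) (k : ℕ) :
    (assignmentMove f)^[2 * k] (.v ⟨0, hn⟩) = .v ⟨k % n, Nat.mod_lt _ hn⟩ := by
  induction k with
  | zero => simp
  | succ k ih =>
    rw [Nat.mul_succ, Function.iterate_succ_apply', Function.iterate_succ_apply', ih]
    simp [assignmentMove]

theorem iterate_assignmentMove_two_mul_add_one {n : ℕ} (hn : 0 < n) (f : Fin n → Prop) (k : ℕ) :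
    (assignmentMove f)^[2 * k + 1] (.v ⟨0, hn⟩) =
      .x ⟨k % n, Nat.mod_lt _ hn⟩ (decide (f ⟨k % n, Nat.mod_lt _ hn⟩)) := by
  rw [Function.iterate_succ_apply', iterate_assignmentMove_two_mul hn]
  rfl

theorem oneLit_mem_InfSet_iff {n : ℕ} (hn : 0 < n) (f : Fin n → Prop) (i : Fin n) :
    oneLit i ∈ InfSet (Out (oneArena n hn) (fun _ _ v => assignmentMove f v)) ↔ f i := by
  have out (m : ℕ) : Out (oneArena n hn) (fun _ _ v => assignmentMove f v) m =
      (assignmentMove f)^[m] (.v ⟨0, hn⟩) := Out_memoryless _ _ m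
  constructor
  · intro h
    obtain ⟨j, -, hj⟩ := h 0
    rw [out] at hj
    rcases Nat.even_or_odd' j with ⟨k, rfl | rfl⟩
    · rw [iterate_assignmentMove_two_mul hn] at hj
      cases hj
    · rw [iterate_assignmentMove_two_mul_add_one hn] at hj
      obtain ⟨rfl, hf⟩ := OneV.x.inj hj
      exact of_decide_eq_true hf
  · intro hf m
    refine ⟨2 * (i + n * m) + 1, by nlinarith, ?_⟩
    have hi : (⟨(i + n * m) % n, Nat.mod_lt _ hn⟩ : Fin n) = i :=
      Fin.ext (by simp [Nat.mod_eq_of_lt i.isLt])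
    rw [out, iterate_assignmentMove_two_mul_add_one hn, hi, decide_eq_true hf]
    rfl

/-- with the single objective `O_p = Muller(φ)`, the formula `φ`
is unsatisfiable iff every profile in `T_{G_φ,α,Pos}` satisfies
`out(t) ∈ Muller(¬φ)`. -/
theorem unsat_iff_Tchar_neg (n : ℕ) (hn : 0 < n) (φ : BForm (Fin n)) :
    (¬ ∃ f : Fin n → Prop, φ.eval f) ↔
      (∀ t ∈ Tchar (oneArena n hn) (fun _ : Unit => Muller (φ.map oneLit))
          (posClass (oneArena n hn)),
        Out (oneArena n hn) t ∈ Muller ((BForm.not φ).map oneLit)) := by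
  have muller (ψ : BForm (Fin n)) (ρ : ℕ → OneV n) :
      ρ ∈ Muller (ψ.map oneLit) ↔ ψ.eval (fun i => oneLit i ∈ InfSet ρ) :=
    BForm.eval_map _ _ ψ
  constructor
  · intro unsat t _
    exact (muller _ _).2 fun h => unsat ⟨_, h⟩
  · rintro H ⟨f, hf⟩
    have win : Out (oneArena n hn) (fun _ _ v => assignmentMove f v) ∈
        Muller (φ.map oneLit) := by
      rw [muller]
      simpa only [oneLit_mem_InfSet_iff] using hf
    exact (muller _ _).1 (H _ (mem_Tchar_of_forall_Out_mem
      (fun _ => ⟨fun _ v => oneEdge_assignmentMove f v, fun _ _ _ => rfl⟩) fun _ => win))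
      ((muller _ _).1 win)

end EpistemicRV
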